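/- Suppose y = Ax + z with x k-sparse in ℝⁿ, A an m×n matrix with m ≥ k, z ~ N(0, σ²I). Then the minimax risk satisfies M*(A) ≥ kσ²/‖A‖_F², where M*(A) = inf_x̂ sup_{x ∈ Σ_k} E[(1/n)‖x̂(y) - x‖²]. -/

import Mathlib

open MeasureTheory ProbabilityTheory Finset Matrix
open scoped ENNReal NNReal

/-- The minimax risk `M*(A) = inf_x̂ sup_{x ∈ Σ_k} E[(1/n)‖x̂(Ax+z) - x‖²]` over `k`-sparse
vectors, with noise `z ~ N(0, σ²I)`. -/
noncomputable def minimaxRisk (m n k : ℕ) (A : Matrix (Fin m) (Fin n) ℝ) (σ : ℝ) : ℝ≥0∞ :=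
  ⨅ est : {f : (Fin m → ℝ) → (Fin n → ℝ) // Measurable f},
    ⨆ x ∈ {x : Fin n → ℝ | ({i | x i ≠ 0} : Set (Fin n)).ncard ≤ k},
      ∫⁻ z, ENNReal.ofReal ((1 / (n : ℝ)) * ∑ i, (est.1 (A.mulVec x + z) i - x i) ^ 2)
        ∂(Measure.pi fun _ : Fin m => gaussianReal 0 (Real.toNNReal (σ ^ 2)))

lemma aux_second_moment {E : Type*} [NormedAddCommGroup E] [InnerProductSpace ℝ E]
    [FiniteDimensional ℝ E] [MeasurableSpace E] [BorelSpace E] (L : StrongDual ℝ E) :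
    ∫⁻ p, ENNReal.ofReal ((L p) ^ 2) ∂(stdGaussian E) = ENNReal.ofReal (‖L‖ ^ 2) := by
  have hL : MemLp L 2 (stdGaussian E) := IsGaussian.memLp_dual _ L 2 (by simp)
  rw [← ofReal_integral_eq_lintegral_ofReal hL.integrable_sq (ae_of_all _ fun _ => sq_nonneg _),
    ← variance_dual_stdGaussian, variance_of_integral_eq_zero hL.aemeasurable
      (integral_strongDual_stdGaussian L)]

lemma aux_key {E : Type*} [NormedAddCommGroup E] [InnerProductSpace ℝ E]
    [FiniteDimensional ℝ E] [MeasurableSpace E] [BorelSpace E] (L : StrongDual ℝ E)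
    (G : E → ℝ) (hG : Measurable G) (w : E) (hw : w ≠ 0) (hGw : ∀ p (s : ℝ), G (p - s • w) = G p) :
    ENNReal.ofReal ((L w) ^ 2 / ‖w‖ ^ 2) ≤
      ∫⁻ p, ENNReal.ofReal ((G p - L p) ^ 2) ∂(stdGaussian E) := by
  have hw' : ‖w‖ ≠ 0 := norm_ne_zero_iff.2 hw
  let R : E ≃ₗᵢ[ℝ] E := (ℝ ∙ w)ᗮ.reflection
  have hR : ∀ p, R p = p - (2 * (inner ℝ w p / ‖w‖ ^ 2)) • w := by
    intro p
    simp only [R, Submodule.reflection_orthogonal_apply, Submodule.reflection_singleton_apply]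
    rw [mul_smul]
    simp [two_smul]
  have hmp : MeasurePreserving R (stdGaussian E) (stdGaussian E) :=
    ⟨R.continuous.measurable, stdGaussian_map R⟩
  have hF : Measurable fun p => ENNReal.ofReal ((G p - L p) ^ 2) := by fun_prop
  have h1 := hmp.lintegral_comp hF
  let L' : StrongDual ℝ E := (L w / ‖w‖ ^ 2) • innerSL ℝ w
  have hL' : ‖L'‖ ^ 2 = (L w) ^ 2 / ‖w‖ ^ 2 := by
    simp only [L', norm_smul, innerSL_apply_norm, mul_pow, Real.norm_eq_abs, sq_abs]
    field_simp
  have h2 : ∫⁻ p, (ENNReal.ofReal ((L' p) ^ 2) + ENNReal.ofReal ((L' p) ^ 2)) ∂(stdGaussian E) ≤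
      ∫⁻ p, (ENNReal.ofReal ((G (R p) - L (R p)) ^ 2) + ENNReal.ofReal ((G p - L p) ^ 2))
        ∂(stdGaussian E) := by
    apply lintegral_mono
    intro p
    simp only
    rw [← ENNReal.ofReal_add (sq_nonneg _) (sq_nonneg _),
      ← ENNReal.ofReal_add (sq_nonneg _) (sq_nonneg _)]
    apply ENNReal.ofReal_le_ofReal
    rw [hR, hGw]
    have : L (p - (2 * (inner ℝ w p / ‖w‖ ^ 2)) • w) = L p - 2 * L' p := by
      simp [L']; ring
    rw [this]
    nlinarith [sq_nonneg (G p - L p + L' p)]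
  rw [lintegral_add_left (by fun_prop), lintegral_add_right _ hF, h1, aux_second_moment, hL',
    ← two_mul, ← two_mul] at h2
  exact (ENNReal.mul_le_mul_iff_right (by simp) (by simp)).1 h2

lemma aux_mp (m n : ℕ) (σ : ℝ) :
    MeasurePreserving (fun p : EuclideanSpace ℝ (Fin n ⊕ Fin m) =>
        ((fun i => p (Sum.inl i) : Fin n → ℝ), (fun i => σ * p (Sum.inr i) : Fin m → ℝ)))
      (stdGaussian _)
      ((Measure.pi fun _ : Fin n => gaussianReal 0 1).prod
        (Measure.pi fun _ : Fin m => gaussianReal 0 (Real.toNNReal (σ ^ 2)))) := by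
  have h0 : MeasurePreserving (MeasurableEquiv.toLp 2 (Fin n ⊕ Fin m → ℝ))
      (Measure.pi fun _ => gaussianReal 0 1) (stdGaussian (EuclideanSpace ℝ (Fin n ⊕ Fin m))) :=
    ⟨MeasurableEquiv.measurable _, map_pi_eq_stdGaussian⟩
  have h1 := h0.symm
  have h2 := measurePreserving_sumPiEquivProdPi (X := fun _ : Fin n ⊕ Fin m => ℝ)
    (fun _ => gaussianReal 0 1)
  have h3 : MeasurePreserving (fun x : Fin m → ℝ => fun i => σ * x i)
      (Measure.pi fun _ => gaussianReal 0 1)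
      (Measure.pi fun _ : Fin m => gaussianReal 0 (Real.toNNReal (σ ^ 2))) := by
    refine measurePreserving_pi _ _ (f := fun _ => fun x : ℝ => σ * x) (fun i => ⟨by fun_prop, ?_⟩)
    rw [gaussianReal_map_const_mul]
    congr 1
    · simp
    · ext; simp [Real.coe_toNNReal _ (sq_nonneg σ)]
  have h4 := (MeasurePreserving.id (Measure.pi fun _ : Fin n => gaussianReal 0 1)).prod h3
  exact h4.comp (h2.comp h1)

lemma aux_subset (n k : ℕ) (hn : 0 < n) (hkn : k ≤ n) (f : Fin n → ℝ) :
    ∃ T : Finset (Fin n), T.card = k ∧ (n : ℝ) * ∑ j ∈ T, f j ≤ k * ∑ j, f j := by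
  have : NeZero n := ⟨hn.ne'⟩
  have hs : ∑ s : Fin n, (n : ℝ) * ∑ i : Fin k, f (s + Fin.castLE hkn i) ≤
      ∑ s : Fin n, k * ∑ j, f j := by
    rw [← Finset.mul_sum, Finset.sum_comm]
    have : ∀ i : Fin k, ∑ s : Fin n, f (s + Fin.castLE hkn i) = ∑ j, f j := fun i =>
      Equiv.sum_comp (Equiv.addRight (Fin.castLE hkn i)) f
    simp [this]
  obtain ⟨s, -, h⟩ := Finset.exists_le_of_sum_le (by simp) hs
  refine ⟨univ.map ⟨fun i : Fin k => s + Fin.castLE hkn i, fun a b h => ?_⟩, by simp, ?_⟩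
  · exact Fin.castLE_injective hkn (add_left_cancel h)
  · rw [Finset.sum_map]
    exact h

lemma aux_alg {ι : Type*} (T : Finset ι) (f : ι → ℝ) (hf : ∀ j, 0 ≤ f j) (n k : ℕ) (hn : 0 < n)
    (hk : 0 < k) (hT : T.card = k) (S τ σ : ℝ) (hσ : σ ≠ 0) (hS : 0 < S)
    (h : (n : ℝ) * ∑ j ∈ T, f j ≤ k * S) :
    k * σ ^ 2 * (τ ^ 2 / (τ ^ 2 * S + n * σ ^ 2)) ≤
      (1 / (n : ℝ)) * ∑ j ∈ T, (τ * σ) ^ 2 / (σ ^ 2 + τ ^ 2 * f j) := by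
  have hσ2 : 0 < σ ^ 2 := by positivity
  have hn' : (0 : ℝ) < n := by exact_mod_cast hn
  have hk' : (0 : ℝ) < k := by exact_mod_cast hk
  have hpos : ∀ j, 0 < σ ^ 2 + τ ^ 2 * f j := fun j => by have := hf j; positivity
  have hcs := Finset.sq_sum_div_le_sum_sq_div T (fun _ => τ * σ) (fun j _ => hpos j)
  have hf0 : 0 ≤ ∑ j ∈ T, f j := Finset.sum_nonneg fun j _ => hf j
  rw [Finset.sum_add_distrib, ← Finset.mul_sum T f (τ ^ 2), Finset.sum_const, Finset.sum_const, hT,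
    nsmul_eq_mul, nsmul_eq_mul] at hcs
  refine le_trans ?_ (mul_le_mul_of_nonneg_left hcs (by positivity))
  have e1 : k * σ ^ 2 * (τ ^ 2 / (τ ^ 2 * S + n * σ ^ 2)) =
      (k * (τ * σ)) ^ 2 / (τ ^ 2 * (k * S) + n * (k * σ ^ 2)) := by
    field_simp
  have e2 : 1 / (n : ℝ) * ((k * (τ * σ)) ^ 2 / (k * σ ^ 2 + τ ^ 2 * ∑ j ∈ T, f j)) =
      (k * (τ * σ)) ^ 2 / (τ ^ 2 * (n * ∑ j ∈ T, f j) + n * (k * σ ^ 2)) := by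
    rw [div_mul_div_comm, one_mul]
    congr 1
    ring
  rw [e1, e2]
  gcongr

lemma aux_risk (m n k : ℕ) (hn : 0 < n) (A : Matrix (Fin m) (Fin n) ℝ) (σ τ : ℝ) (hσ : σ ≠ 0)
    (g : (Fin m → ℝ) → (Fin n → ℝ)) (hg : Measurable g) (T : Finset (Fin n)) (hT : T.card = k) :
    ENNReal.ofReal ((1 / (n : ℝ)) * ∑ j ∈ T, (τ * σ) ^ 2 / (σ ^ 2 + τ ^ 2 * ∑ i, A i j ^ 2)) ≤
    ⨆ x ∈ {x : Fin n → ℝ | ({i | x i ≠ 0} : Set (Fin n)).ncard ≤ k},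
      ∫⁻ z, ENNReal.ofReal ((1 / (n : ℝ)) * ∑ i, (g (A.mulVec x + z) i - x i) ^ 2)
        ∂(Measure.pi fun _ : Fin m => gaussianReal 0 (Real.toNNReal (σ ^ 2))) := by
  set M := ⨆ x ∈ {x : Fin n → ℝ | ({i | x i ≠ 0} : Set (Fin n)).ncard ≤ k},
      ∫⁻ z, ENNReal.ofReal ((1 / (n : ℝ)) * ∑ i, (g (A.mulVec x + z) i - x i) ^ 2)
        ∂(Measure.pi fun _ : Fin m => gaussianReal 0 (Real.toNNReal (σ ^ 2))) with hM
  let X : (Fin n → ℝ) → (Fin n → ℝ) := fun ξ i => if i ∈ T then τ * ξ i else 0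
  have hX : Measurable X := by
    refine measurable_pi_lambda _ fun i => ?_
    by_cases hi : i ∈ T <;> simp only [X, hi, if_true, if_false] <;> fun_prop
  have hA : Measurable fun x : Fin n → ℝ => A.mulVec x :=
    (Continuous.matrix_mulVec continuous_const continuous_id).measurable
  have hX' : ∀ ξ, X ξ ∈ {x : Fin n → ℝ | ({i | x i ≠ 0} : Set (Fin n)).ncard ≤ k} := by
    intro ξ
    simp only [Set.mem_ofPred_eq]
    rw [← hT, ← Set.ncard_coe_finset]
    refine Set.ncard_le_ncard ?_ (Finset.finite_toSet T)
    intro i hi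
    by_contra hc
    apply hi
    simp only [X]
    exact if_neg hc
  let F : (Fin n → ℝ) × (Fin m → ℝ) → ℝ≥0∞ := fun q =>
    ENNReal.ofReal ((1 / (n : ℝ)) * ∑ i, (g (A.mulVec (X q.1) + q.2) i - X q.1 i) ^ 2)
  have hgi : ∀ i, Measurable fun q : (Fin n → ℝ) × (Fin m → ℝ) => g (A.mulVec (X q.1) + q.2) i :=
    fun i => (measurable_pi_apply i).comp (hg.comp
      ((hA.comp (hX.comp measurable_fst)).add measurable_snd))
  have hXi : ∀ i, Measurable fun q : (Fin n → ℝ) × (Fin m → ℝ) => X q.1 i :=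
    fun i => (measurable_pi_apply i).comp (hX.comp measurable_fst)
  have hF : Measurable F := by
    apply ENNReal.measurable_ofReal.comp
    apply Measurable.const_mul
    exact Finset.measurable_fun_sum _ fun i _ => ((hgi i).sub (hXi i)).pow_const 2
  have h1 : ∫⁻ q, F q ∂((Measure.pi fun _ : Fin n => gaussianReal 0 1).prod
        (Measure.pi fun _ : Fin m => gaussianReal 0 (Real.toNNReal (σ ^ 2)))) ≤ M := by
    rw [lintegral_prod _ hF.aemeasurable]
    calc _ ≤ ∫⁻ ξ : Fin n → ℝ, M ∂(Measure.pi fun _ : Fin n => gaussianReal 0 1) := by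
          apply lintegral_mono
          intro ξ
          exact le_iSup₂_of_le (X ξ) (hX' ξ) le_rfl
      _ = M := by simp
  refine le_trans ?_ h1
  rw [← (aux_mp m n σ).lintegral_comp hF]
  rw [ENNReal.ofReal_mul (by positivity), ENNReal.ofReal_sum_of_nonneg (fun j _ => by positivity)]
  let Φ := (fun p : EuclideanSpace ℝ (Fin n ⊕ Fin m) =>
        ((fun i => p (Sum.inl i) : Fin n → ℝ), (fun i => σ * p (Sum.inr i) : Fin m → ℝ)))
  have hΦ : Measurable Φ := (aux_mp m n σ).measurable
  have hG : ∀ j, Measurable fun p => g (A.mulVec (X (Φ p).1) + (Φ p).2) j := fun j =>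
    (hgi j).comp hΦ
  have hXj : ∀ j, Measurable fun p => X (Φ p).1 j := fun j => (hXi j).comp hΦ
  calc _ ≤ ENNReal.ofReal (1 / (n : ℝ)) * ∑ j ∈ T, ∫⁻ p : EuclideanSpace ℝ (Fin n ⊕ Fin m),
        ENNReal.ofReal ((g (A.mulVec (X (Φ p).1) + (Φ p).2) j - X (Φ p).1 j) ^ 2)
          ∂(stdGaussian _) := by
        gcongr with j hj
        let L : StrongDual ℝ (EuclideanSpace ℝ (Fin n ⊕ Fin m)) :=
          τ • EuclideanSpace.proj (Sum.inl j)
        let w : EuclideanSpace ℝ (Fin n ⊕ Fin m) :=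
          WithLp.toLp 2 (Sum.elim (fun i => if i = j then σ else 0) (fun i => - τ * A i j))
        have hL : ∀ p, X (Φ p).1 j = L p := by
          intro p; simp [X, Φ, L, hj]
        have hLw : L w = τ * σ := by simp [L, w]
        have hwn : ‖w‖ ^ 2 = σ ^ 2 + τ ^ 2 * ∑ i, A i j ^ 2 := by
          rw [EuclideanSpace.real_norm_sq_eq]
          simp [w, mul_pow, Finset.mul_sum]
        have hw : w ≠ 0 := by
          intro h0
          have : w (Sum.inl j) = 0 := by rw [h0]; rfl
          simp [w, hσ] at this
        have := aux_key L (fun p => g (A.mulVec (X (Φ p).1) + (Φ p).2) j) (hG j) w hw ?_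
        · rw [hLw, hwn] at this
          simpa only [hL] using this
        · intro p s
          have : A.mulVec (X (Φ (p - s • w)).1) + (Φ (p - s • w)).2
              = A.mulVec (X (Φ p).1) + (Φ p).2 := by
            have e : X (Φ (p - s • w)).1 = X (Φ p).1 - Pi.single j (τ * s * σ) := by
              ext i
              by_cases hij : i = j
              · subst hij; simp [X, Φ, w, hj]; ring
              · simp [X, Φ, w, hij]
            rw [e, Matrix.mulVec_sub]
            ext i
            simp [Φ, w]
            ring
          simp only [this]
    _ ≤ ENNReal.ofReal (1 / (n : ℝ)) * ∑ j, ∫⁻ p : EuclideanSpace ℝ (Fin n ⊕ Fin m),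
        ENNReal.ofReal ((g (A.mulVec (X (Φ p).1) + (Φ p).2) j - X (Φ p).1 j) ^ 2)
          ∂(stdGaussian _) := by
        refine mul_le_mul_right ?_ _
        exact Finset.sum_le_sum_of_subset (Finset.subset_univ T)
    _ = _ := by
        have hm : ∀ j, Measurable fun p : EuclideanSpace ℝ (Fin n ⊕ Fin m) =>
            ENNReal.ofReal ((g (A.mulVec (X (Φ p).1) + (Φ p).2) j - X (Φ p).1 j) ^ 2) :=
          fun j => ENNReal.measurable_ofReal.comp (((hG j).sub (hXj j)).pow_const 2)
        rw [← lintegral_finsetSum _ (fun j _ => hm j), ← lintegral_const_mul]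
        · refine lintegral_congr fun p => ?_
          simp only [F]
          rw [ENNReal.ofReal_mul (by positivity),
            ENNReal.ofReal_sum_of_nonneg (fun j _ => sq_nonneg _)]
        · exact Finset.measurable_fun_sum _ fun j _ => hm j

/-- For observations `y = Ax + z` with `x` `k`-sparse, `m ≥ k` and `z ~ N(0, σ²I)`, the
minimax risk satisfies `M*(A) ≥ kσ²/‖A‖_F²`. -/
theorem stmt_17 (m n k : ℕ) (hn : 0 < n) (hk : 0 < k) (hkm : k ≤ m) (hkn : k ≤ n)
    (σ : ℝ) (A : Matrix (Fin m) (Fin n) ℝ) :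
    ENNReal.ofReal ((k : ℝ) * σ ^ 2 / ∑ i, ∑ j, A i j ^ 2) ≤ minimaxRisk m n k A σ := by
  set S := ∑ i, ∑ j, A i j ^ 2 with hSdef
  by_cases hσ : σ = 0
  · simp [hσ]
  by_cases hS0 : S = 0
  · simp [hS0]
  have hS : 0 < S := lt_of_le_of_ne (by positivity) (Ne.symm hS0)
  unfold _root_.minimaxRisk
  refine le_iInf fun est => ?_
  obtain ⟨T, hT, hle⟩ := aux_subset n k hn hkn (fun j => ∑ i, A i j ^ 2)
  have hS2 : ∑ j, ∑ i, A i j ^ 2 = S := by rw [hSdef, Finset.sum_comm]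
  rw [hS2] at hle
  have key := fun τ : ℝ => (ENNReal.ofReal_le_ofReal (aux_alg T (fun j => ∑ i, A i j ^ 2)
    (fun j => by positivity) n k hn hk hT S τ σ hσ hS hle)).trans
      (aux_risk m n k hn A σ τ hσ est.1 est.2 T hT)
  have lim : Filter.Tendsto (fun τ : ℝ => ENNReal.ofReal
      (k * σ ^ 2 * (τ ^ 2 / (τ ^ 2 * S + n * σ ^ 2)))) Filter.atTop
      (nhds (ENNReal.ofReal ((k : ℝ) * σ ^ 2 / S))) := by
    apply ENNReal.tendsto_ofReal
    have h1 : Filter.Tendsto (fun τ : ℝ => k * σ ^ 2 * (S + n * σ ^ 2 * (τ ^ 2)⁻¹)⁻¹) Filter.atTop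
        (nhds (k * σ ^ 2 * (S + n * σ ^ 2 * 0)⁻¹)) := by
      refine (Filter.Tendsto.inv₀ ?_ (by simpa using hS0)).const_mul _
      refine (Filter.Tendsto.const_mul _ ?_).const_add _
      exact (Filter.tendsto_pow_atTop two_ne_zero).inv_tendsto_atTop
    rw [mul_zero, add_zero, ← div_eq_mul_inv] at h1
    refine h1.congr' ?_
    filter_upwards [Filter.eventually_gt_atTop 0] with τ hτ
    have : 0 < τ ^ 2 * S + n * σ ^ 2 := by positivity
    have : 0 < S + n * σ ^ 2 * (τ ^ 2)⁻¹ := by positivity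
    field_simp
  exact le_of_tendsto' lim key
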